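/- Let Q(x₁,x₂,x₃,x₄) be an affine-linear polynomial with complex coefficients and set h^{ij} := δ_{x_k,x_l}(Q) for {i,j,k,l} = {1,2,3,4}. Let ℓ := h^{23}_{x₃x₃} h^{34} − h^{23}_{x₃} h^{34}_{x₃} + h^{23} h^{34}_{x₃x₃}. Then the polynomial identity 4·i₃(h^{12})·h^{14} = det [[h^{12}, h^{12}_{x₁}, ℓ], [h^{12}_{x₂}, h^{12}_{x₁x₂}, ℓ_{x₂}], [h^{12}_{x₂x₂}, h^{12}_{x₁x₂x₂}, ℓ_{x₂x₂}]] holds in ℂ[x₁,x₂,x₃,x₄]. -/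

import Mathlib

open MvPolynomial

/-- `δ_{x_i,x_j}(Q) = Q_{x_i} Q_{x_j} - Q Q_{x_i x_j}`. -/
noncomputable def dd (i j : Fin 4) (Q : MvPolynomial (Fin 4) ℂ) : MvPolynomial (Fin 4) ℂ :=
  pderiv i Q * pderiv j Q - Q * pderiv i (pderiv j Q)

/-- The relative invariant
`i₃ = (1/4)·det [[h, h_x, h_xx], [h_y, h_xy, h_xxy], [h_yy, h_xyy, h_xxyy]]`
of a biquadratic polynomial in the variables `x_i, x_j`. -/
noncomputable def inv3 (i j : Fin 4) (h : MvPolynomial (Fin 4) ℂ) : MvPolynomial (Fin 4) ℂ :=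
  C (1 / 4 : ℂ) * Matrix.det
    !![h, pderiv i h, pderiv i (pderiv i h);
       pderiv j h, pderiv i (pderiv j h), pderiv i (pderiv i (pderiv j h));
       pderiv j (pderiv j h), pderiv i (pderiv j (pderiv j h)),
         pderiv i (pderiv i (pderiv j (pderiv j h)))]

/-- Partial derivatives of a multivariate polynomial commute. -/
theorem pderiv_pderiv_comm {σ R : Type*} [CommRing R] (i j : σ) (f : MvPolynomial σ R) :
    pderiv i (pderiv j f) = pderiv j (pderiv i f) := by
  classical
  have h : ⁅pderiv (R := R) i, pderiv (R := R) j⁆ = 0 := by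
    refine derivation_ext fun k => ?_
    rw [Derivation.commutator_apply, pderiv_X, pderiv_X, Pi.single_apply, Pi.single_apply]
    split_ifs <;> simp
  have h' := congrArg (fun D => D f) h
  rw [Derivation.commutator_apply] at h'
  exact sub_eq_zero.mp h'

/-- A polynomial of degree at most one in a variable has zero second derivative in it. -/
theorem pderiv_pderiv_self_eq_zero {σ R : Type*} [CommRing R] {i : σ} {f : MvPolynomial σ R}
    (hf : f.degreeOf i ≤ 1) : pderiv i (pderiv i f) = 0 := by
  classical
  ext m
  rw [coeff_pderiv, coeff_pderiv]
  have h : f.coeff (m + Finsupp.single i 1 + Finsupp.single i 1) = 0 := by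
    by_contra hne
    have hle := monomial_le_degreeOf i (mem_support_iff.mpr hne)
    simp at hle
    omega
  simp [h]

/-- The polynomial `δ_{x_i,x_j}(Q)` does not involve `x_i`. -/
theorem pderiv_dd_left {Q : MvPolynomial (Fin 4) ℂ} {i j : Fin 4} (hi : Q.degreeOf i ≤ 1) :
    pderiv i (dd i j Q) = 0 := by
  have h := pderiv_pderiv_self_eq_zero hi
  have h' : pderiv i (pderiv i (pderiv j Q)) = 0 := by
    rw [pderiv_pderiv_comm i j, pderiv_pderiv_comm i j, h, map_zero]
  simp only [dd, map_sub, pderiv_mul, h, h']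
  ring

/-- The second transvectant of `h^{23}` and `h^{34}` in `x₃` equals that of `h^{12}` and `h^{14}`
in `x₁`. -/
theorem transvectant_dd_eq {Q : MvPolynomial (Fin 4) ℂ} (hQ : ∀ i, Q.degreeOf i ≤ 1) :
    pderiv 2 (pderiv 2 (dd 0 3 Q)) * dd 0 1 Q - pderiv 2 (dd 0 3 Q) * pderiv 2 (dd 0 1 Q)
        + dd 0 3 Q * pderiv 2 (pderiv 2 (dd 0 1 Q)) =
      pderiv 0 (pderiv 0 (dd 2 3 Q)) * dd 1 2 Q - pderiv 0 (dd 2 3 Q) * pderiv 0 (dd 1 2 Q)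
        + dd 2 3 Q * pderiv 0 (pderiv 0 (dd 1 2 Q)) := by
  have h1 (i : Fin 4) : pderiv i (pderiv i Q) = 0 := pderiv_pderiv_self_eq_zero (hQ i)
  have h2 (i j : Fin 4) : pderiv i (pderiv i (pderiv j Q)) = 0 := by
    rw [pderiv_pderiv_comm i j, pderiv_pderiv_comm i j, h1, map_zero]
  have h3 (i j k : Fin 4) : pderiv i (pderiv i (pderiv j (pderiv k Q))) = 0 := by
    rw [pderiv_pderiv_comm i j, pderiv_pderiv_comm i j, h2, map_zero]
  simp only [dd, map_sub, map_add, pderiv_mul, map_zero, h1, h2, h3,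
    pderiv_pderiv_comm (R := ℂ) (2 : Fin 4) 0,
    pderiv_pderiv_comm (R := ℂ) (2 : Fin 4) 1]
  ring

/-- Identity (2.8) of the paper: with `h^{ij} := δ_{x_k,x_l}(Q)` (so `h^{12} = dd 2 3 Q`,
`h^{23} = dd 0 3 Q`, `h^{34} = dd 0 1 Q`, `h^{14} = dd 1 2 Q`, variables indexed `0,1,2,3`)
and `ℓ = h^{23}_{x₃x₃} h^{34} - h^{23}_{x₃} h^{34}_{x₃} + h^{23} h^{34}_{x₃x₃}`, one has
`4 i₃(h^{12}, x₁, x₂) h^{14} = det [[h^{12}, h^{12}_{x₁}, ℓ], [h^{12}_{x₂}, h^{12}_{x₁x₂}, ℓ_{x₂}],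
[h^{12}_{x₂x₂}, h^{12}_{x₁x₂x₂}, ℓ_{x₂x₂}]]`. -/
theorem statement3 (Q : MvPolynomial (Fin 4) ℂ) (hQ : ∀ i, Q.degreeOf i ≤ 1) :
    4 * inv3 0 1 (dd 2 3 Q) * dd 1 2 Q =
      Matrix.det
        !![dd 2 3 Q, pderiv 0 (dd 2 3 Q),
             pderiv 2 (pderiv 2 (dd 0 3 Q)) * dd 0 1 Q
               - pderiv 2 (dd 0 3 Q) * pderiv 2 (dd 0 1 Q)
               + dd 0 3 Q * pderiv 2 (pderiv 2 (dd 0 1 Q));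
           pderiv 1 (dd 2 3 Q), pderiv 0 (pderiv 1 (dd 2 3 Q)),
             pderiv 1 (pderiv 2 (pderiv 2 (dd 0 3 Q)) * dd 0 1 Q
               - pderiv 2 (dd 0 3 Q) * pderiv 2 (dd 0 1 Q)
               + dd 0 3 Q * pderiv 2 (pderiv 2 (dd 0 1 Q)));
           pderiv 1 (pderiv 1 (dd 2 3 Q)), pderiv 0 (pderiv 1 (pderiv 1 (dd 2 3 Q))),
             pderiv 1 (pderiv 1 (pderiv 2 (pderiv 2 (dd 0 3 Q)) * dd 0 1 Q
               - pderiv 2 (dd 0 3 Q) * pderiv 2 (dd 0 1 Q)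
               + dd 0 3 Q * pderiv 2 (pderiv 2 (dd 0 1 Q))))] := by
  have hg : pderiv 1 (dd 1 2 Q) = 0 := pderiv_dd_left (hQ 1)
  have hg0 : pderiv 1 (pderiv 0 (dd 1 2 Q)) = 0 := by rw [pderiv_pderiv_comm, hg, map_zero]
  have hg00 : pderiv 1 (pderiv 0 (pderiv 0 (dd 1 2 Q))) = 0 := by
    rw [pderiv_pderiv_comm, hg0, map_zero]
  have h4 : (4 : MvPolynomial (Fin 4) ℂ) * C (1 / 4 : ℂ) = 1 := by
    rw [show (4 : MvPolynomial (Fin 4) ℂ) = C 4 from (map_ofNat C 4).symm, ← C_mul]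
    norm_num
  rw [transvectant_dd_eq hQ, inv3, ← mul_assoc 4, h4, one_mul]
  generalize dd 1 2 Q = g at *
  generalize dd 2 3 Q = h
  simp only [map_sub, map_add, pderiv_mul, map_zero, hg, hg0, hg00,
    pderiv_pderiv_comm (R := ℂ) (1 : Fin 4) 0, Matrix.det_fin_three, Matrix.of_apply,
    Matrix.cons_val', Matrix.cons_val_zero, Matrix.cons_val_one, Matrix.cons_val]
  ring
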